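/- On ℝ^{2n} with coordinates (t, q, x_2, y_2, ..., x_n, y_n) and the folded symplectic form ω = t dt ∧ dq + Σ_{i=2}^n dx_i ∧ dy_i, a smooth function f admits a smooth vector field X with ι_X ω = -df if and only if ∂f/∂q is divisible by t^2 and ∂f/∂t is divisible by t; equivalently, f = t²f₁ + f₂(x_2, y_2, ..., x_n, y_n) for smooth functions f₁ and f₂. -/

import Mathlib

open scoped BigOperators

/-- The point/tangent space `ℝ^{2n}` with coordinates `(t, q, x, y)`,
`x, y : Fin m → ℝ` with `m = n - 1`. -/
abbrev FoldedSpace (m : ℕ) := ℝ × ℝ × (Fin m → ℝ) × (Fin m → ℝ)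

/-- The folded symplectic form `ω = t dt ∧ dq + Σᵢ dxᵢ ∧ dyᵢ` evaluated at the
point `p` on tangent vectors `u`, `v`. -/
def foldedForm (m : ℕ) (p u v : FoldedSpace m) : ℝ :=
  p.1 * (u.1 * v.2.1 - v.1 * u.2.1) +
    ∑ i : Fin m, (u.2.2.1 i * v.2.2.2 i - v.2.2.1 i * u.2.2.2 i)

open MeasureTheory in
/-- Differentiation under the integral sign, all orders. -/
theorem contDiff_param_integral {E : Type} [NormedAddCommGroup E] [NormedSpace ℝ E]
    [ProperSpace E] (n : ℕ) :
    ∀ {F : Type} [NormedAddCommGroup F] [NormedSpace ℝ F] [CompleteSpace F]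
      (φ : E × ℝ → F), ContDiff ℝ n φ →
      ContDiff ℝ n (fun p => ∫ s in (0:ℝ)..1, φ (p, s)) := by
  induction n with
  | zero =>
    intro F _ _ _ φ hφ
    have hc : Continuous φ := hφ.continuous
    refine contDiff_zero.2 ?_
    exact intervalIntegral.continuous_parametric_intervalIntegral_of_continuous'
      (f := fun p s => φ (p, s)) (show Continuous (Function.uncurry fun p s => φ (p, s)) from hc) 0 1
  | succ n ih =>
    intro F _ _ _ φ hφ
    have hc : Continuous φ := hφ.continuous
    have hd : Differentiable ℝ φ := hφ.differentiable (by simp)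
    let ψ : E × ℝ → (E →L[ℝ] F) := fun z =>
      (fderiv ℝ φ z).comp (ContinuousLinearMap.inl ℝ E ℝ)
    have hψ : ContDiff ℝ n ψ := by
      have h1 : ContDiff ℝ n (fderiv ℝ φ) := hφ.fderiv_right (by norm_cast)
      exact h1.clm_comp contDiff_const
    have hψc : Continuous ψ := hψ.continuous
    push_cast
    rw [contDiff_succ_iff_hasFDerivAt]
    refine ⟨fun p => ∫ s in (0:ℝ)..1, ψ (p, s), ih ψ hψ, fun p => ?_⟩
    have hK : IsCompact (Metric.closedBall p 1 ×ˢ Set.Icc (0:ℝ) 1) :=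
      (isCompact_closedBall p 1).prod isCompact_Icc
    obtain ⟨C, hC⟩ := hK.exists_bound_of_continuousOn hψc.continuousOn
    refine intervalIntegral.hasFDerivAt_integral_of_dominated_of_fderiv_le
      (F := fun p s => φ (p, s)) (F' := fun p s => ψ (p, s)) (bound := fun _ => C)
      (Metric.closedBall_mem_nhds p one_pos) ?_ ?_ ?_ ?_ ?_ ?_
    · exact Filter.Eventually.of_forall fun x =>
        (Continuous.aestronglyMeasurable (by fun_prop))
    · exact Continuous.intervalIntegrable (by fun_prop) _ _
    · exact Continuous.aestronglyMeasurable (by fun_prop)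
    · refine Filter.Eventually.of_forall fun s hs x hx => hC (x, s) ⟨hx, ?_⟩
      rw [Set.uIoc_of_le zero_le_one] at hs
      exact ⟨hs.1.le, hs.2⟩
    · exact intervalIntegrable_const
    · refine Filter.Eventually.of_forall fun s hs x hx => ?_
      have h1 : HasFDerivAt (fun x : E => (x, s)) (ContinuousLinearMap.inl ℝ E ℝ) x :=
        hasFDerivAt_prodMk_left x s
      exact (hd (x, s)).hasFDerivAt.comp x h1

/-- Hadamard's lemma in the first variable. -/
theorem hadamard_first {E : Type} [NormedAddCommGroup E] [NormedSpace ℝ E]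
    [ProperSpace E] (g : ℝ × E → ℝ) (hg : ContDiff ℝ (⊤ : ℕ∞) g) :
    ∃ h : ℝ × E → ℝ, ContDiff ℝ (⊤ : ℕ∞) h ∧
      (∀ p, g p - g (0, p.2) = p.1 * h p) ∧
      ∀ y, h (0, y) = fderiv ℝ g (0, y) (1, 0) := by
  let φ : (ℝ × E) × ℝ → ℝ := fun z => fderiv ℝ g (z.2 * z.1.1, z.1.2) (1, 0)
  have hg' : ContDiff ℝ (⊤ : ℕ∞) (fderiv ℝ g) := hg.fderiv_right (by norm_cast)
  have hφ : ContDiff ℝ (⊤ : ℕ∞) φ := by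
    have h1 : ContDiff ℝ (⊤ : ℕ∞)
        (fun z : (ℝ × E) × ℝ => ((z.2 * z.1.1, z.1.2) : ℝ × E)) := by fun_prop
    exact (hg'.comp h1).clm_apply contDiff_const
  refine ⟨fun p => ∫ s in (0:ℝ)..1, φ (p, s), ?_, ?_, ?_⟩
  · rw [contDiff_infty]
    intro n
    exact contDiff_param_integral n φ (hφ.of_le (by exact_mod_cast le_top))
  · intro p
    have hder : ∀ s ∈ Set.uIcc (0:ℝ) 1,
        HasDerivAt (fun s : ℝ => g (s * p.1, p.2)) (p.1 * φ (p, s)) s := by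
      intro s _
      have h1 : HasDerivAt (fun s : ℝ => ((s * p.1, p.2) : ℝ × E)) (p.1, 0) s := by
        have := (hasDerivAt_id s).mul_const p.1
        exact (by simpa using this : HasDerivAt (fun s : ℝ => s * p.1) p.1 s).prodMk
          (hasDerivAt_const s p.2)
      have h2 := ((hg.differentiable (by simp)) (s * p.1, p.2)).hasFDerivAt.comp_hasDerivAt s h1
      have h3 : ((p.1, 0) : ℝ × E) = p.1 • (1, 0) := by simp
      rw [h3, map_smul] at h2
      exact h2
    have hcont : Continuous (fun s => p.1 * φ (p, s)) := by
      have := hφ.continuous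
      fun_prop
    have := intervalIntegral.integral_eq_sub_of_hasDerivAt hder (hcont.intervalIntegrable _ _)
    rw [intervalIntegral.integral_const_mul] at this
    simpa using this.symm
  · intro y
    simp [φ]

theorem folded_A_C (m : ℕ) (f : FoldedSpace m → ℝ) (hf : ContDiff ℝ (⊤ : ℕ∞) f)
    (hX : ∃ X : FoldedSpace m → FoldedSpace m, ContDiff ℝ (⊤ : ℕ∞) X ∧
        ∀ p v, foldedForm m p (X p) v = - fderiv ℝ f p v) :
    ∃ f₁ : FoldedSpace m → ℝ, ∃ f₂ : (Fin m → ℝ) × (Fin m → ℝ) → ℝ,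
        ContDiff ℝ (⊤ : ℕ∞) f₁ ∧ ContDiff ℝ (⊤ : ℕ∞) f₂ ∧
        ∀ p : FoldedSpace m, f p = p.1 ^ 2 * f₁ p + f₂ (p.2.2.1, p.2.2.2) := by
  obtain ⟨X, -, hX⟩ := hX
  have ht : ∀ y, fderiv ℝ f (0, y) (1, 0) = 0 := by
    intro y
    have := hX (0, y) (1, 0)
    simp [foldedForm] at this
    exact this
  have hq : ∀ y, fderiv ℝ f (0, y) (0, 1, 0, 0) = 0 := by
    intro y
    have := hX (0, y) (0, 1, 0, 0)
    simp [foldedForm] at this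
    exact this
  obtain ⟨h, hh, hh1, hh2⟩ := hadamard_first f hf
  obtain ⟨k, hk, hk1, -⟩ := hadamard_first h hh
  refine ⟨k, fun w => f (0, 0, w), hk, by fun_prop, ?_⟩
  rintro ⟨t, q, x, y⟩
  have hconst : f (0, q, x, y) = f (0, 0, x, y) := by
    have hder : ∀ s : ℝ, HasDerivAt (fun s : ℝ => f (0, s, x, y)) 0 s := by
      intro s
      have h1 : HasDerivAt (fun s : ℝ => ((0, s, x, y) : FoldedSpace m)) (0, 1, 0, 0) s :=
        (hasDerivAt_const s (0:ℝ)).prodMk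
          ((hasDerivAt_id s).prodMk (hasDerivAt_const s (x, y)))
      have h2 := ((hf.differentiable (by simp)) (0, s, x, y)).hasFDerivAt.comp_hasDerivAt s h1
      rw [hq] at h2
      exact h2
    exact is_const_of_deriv_eq_zero (fun s => (hder s).differentiableAt)
      (fun s => (hder s).deriv) q 0
  have e1 := hh1 (t, q, x, y)
  have e2 := hk1 (t, q, x, y)
  simp only [hh2, ht] at e1 e2
  simp only
  rw [← hconst]
  linear_combination e1 + t * e2

theorem folded_C_B (m : ℕ) (f : FoldedSpace m → ℝ)
    (hC : ∃ f₁ : FoldedSpace m → ℝ, ∃ f₂ : (Fin m → ℝ) × (Fin m → ℝ) → ℝ,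
        ContDiff ℝ (⊤ : ℕ∞) f₁ ∧ ContDiff ℝ (⊤ : ℕ∞) f₂ ∧
        ∀ p : FoldedSpace m, f p = p.1 ^ 2 * f₁ p + f₂ (p.2.2.1, p.2.2.2)) :
    (∃ H : FoldedSpace m → ℝ, ContDiff ℝ (⊤ : ℕ∞) H ∧
          ∀ p, fderiv ℝ f p (0, 1, 0, 0) = p.1 ^ 2 * H p) ∧
        (∃ G : FoldedSpace m → ℝ, ContDiff ℝ (⊤ : ℕ∞) G ∧
          ∀ p, fderiv ℝ f p (1, 0, 0, 0) = p.1 * G p) := by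
  obtain ⟨f₁, f₂, h1, h2, he⟩ := hC
  have hg' : ContDiff ℝ (⊤ : ℕ∞) (fderiv ℝ f₁) := h1.fderiv_right (by norm_cast)
  have key : ∀ p v : FoldedSpace m, fderiv ℝ f p v =
      p.1 ^ 2 * fderiv ℝ f₁ p v + 2 * p.1 * v.1 * f₁ p + fderiv ℝ f₂ p.2.2 v.2.2 := by
    intro p v
    have a1 : HasFDerivAt (fun p : FoldedSpace m => p.1) (ContinuousLinearMap.fst ℝ _ _) p :=
      hasFDerivAt_fst
    have a2 := (h1.differentiable (by simp) p).hasFDerivAt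
    have a3 : HasFDerivAt (fun p : FoldedSpace m => p.2.2)
      ((ContinuousLinearMap.snd ℝ _ _).comp (ContinuousLinearMap.snd ℝ _ _)) p :=
      hasFDerivAt_snd.comp p hasFDerivAt_snd
    have a4 := ((h2.differentiable (by simp)) p.2.2).hasFDerivAt.comp p a3
    have a5 := ((a1.pow 2).mul a2).add a4
    have e : f = (fun x : FoldedSpace m => x.1 ^ 2) * f₁ + f₂ ∘ fun p => p.2.2 := funext he
    rw [← e] at a5
    rw [a5.fderiv]
    simp
    ring
  refine ⟨⟨fun p => fderiv ℝ f₁ p (0, 1, 0, 0), hg'.clm_apply contDiff_const, fun p => ?_⟩,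
    ⟨fun p => p.1 * fderiv ℝ f₁ p (1, 0, 0, 0) + 2 * f₁ p, ?_, fun p => ?_⟩⟩
  · rw [key]
    have : (0 : (Fin m → ℝ) × (Fin m → ℝ)) = (0, 0) := rfl
    simp [← this]
  · have := hg'.clm_apply (contDiff_const (c := ((1, 0, 0, 0) : FoldedSpace m)))
    fun_prop
  · rw [key]
    have : (0 : (Fin m → ℝ) × (Fin m → ℝ)) = (0, 0) := rfl
    simp [← this]
    ring

theorem folded_B_A (m : ℕ) (f : FoldedSpace m → ℝ) (hf : ContDiff ℝ (⊤ : ℕ∞) f)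
    (hB : (∃ H : FoldedSpace m → ℝ, ContDiff ℝ (⊤ : ℕ∞) H ∧
          ∀ p, fderiv ℝ f p (0, 1, 0, 0) = p.1 ^ 2 * H p) ∧
        (∃ G : FoldedSpace m → ℝ, ContDiff ℝ (⊤ : ℕ∞) G ∧
          ∀ p, fderiv ℝ f p (1, 0, 0, 0) = p.1 * G p)) :
    ∃ X : FoldedSpace m → FoldedSpace m, ContDiff ℝ (⊤ : ℕ∞) X ∧
        ∀ p v, foldedForm m p (X p) v = - fderiv ℝ f p v := by
  obtain ⟨⟨H, hH, hH1⟩, G, hG, hG1⟩ := hB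
  have hg' : ContDiff ℝ (⊤ : ℕ∞) (fderiv ℝ f) := hf.fderiv_right (by norm_cast)
  refine ⟨fun p => (- (p.1 * H p), G p,
    (fun i => - fderiv ℝ f p (0, 0, 0, Pi.single i 1)),
    (fun i => fderiv ℝ f p (0, 0, Pi.single i 1, 0))), ?_, ?_⟩
  · refine ContDiff.prodMk (by fun_prop) (hG.prodMk (ContDiff.prodMk ?_ ?_))
    · exact contDiff_pi.2 fun i => (hg'.clm_apply contDiff_const).neg
    · exact contDiff_pi.2 fun i => hg'.clm_apply contDiff_const
  · rintro p ⟨a, b, x, y⟩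
    have hdec : ((a, b, x, y) : FoldedSpace m) = a • (1, 0, 0, 0) + b • (0, 1, 0, 0)
        + ∑ i, x i • ((0, 0, Pi.single i 1, 0) : FoldedSpace m)
        + ∑ i, y i • ((0, 0, 0, Pi.single i 1) : FoldedSpace m) := by
      ext j <;> simp [Prod.fst_sum, Prod.snd_sum, Finset.sum_apply, Pi.single_apply]
    rw [hdec]
    simp only [map_add, map_smul, map_sum, hH1, hG1]
    rw [← hdec]
    simp only [foldedForm, smul_eq_mul, Finset.sum_sub_distrib, neg_mul, Finset.sum_neg_distrib]
    have e1 : ∀ g : Fin m → ℝ, ∑ i, g i * y i = ∑ i, y i * g i :=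
      fun g => Finset.sum_congr rfl fun i _ => mul_comm _ _
    rw [e1]
    ring

/-- On `ℝ^{2n}` with the folded symplectic form
`ω = t dt ∧ dq + Σ dxᵢ ∧ dyᵢ`, a smooth function `f` admits a smooth vector
field `X` with `ι_X ω = -df` if and only if `∂f/∂q` is divisible by `t²` and
`∂f/∂t` is divisible by `t`; equivalently, `f = t² f₁ + f₂(x, y)` for smooth
functions `f₁, f₂`.  (Here `t = p.1`, `q = p.2.1`.) -/
theorem folded_function_characterization (m : ℕ)
    (f : FoldedSpace m → ℝ) (hf : ContDiff ℝ (⊤ : ℕ∞) f) :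
    ((∃ X : FoldedSpace m → FoldedSpace m, ContDiff ℝ (⊤ : ℕ∞) X ∧
        ∀ p v, foldedForm m p (X p) v = - fderiv ℝ f p v)
      ↔
      ((∃ H : FoldedSpace m → ℝ, ContDiff ℝ (⊤ : ℕ∞) H ∧
          ∀ p, fderiv ℝ f p (0, 1, 0, 0) = p.1 ^ 2 * H p) ∧
        (∃ G : FoldedSpace m → ℝ, ContDiff ℝ (⊤ : ℕ∞) G ∧
          ∀ p, fderiv ℝ f p (1, 0, 0, 0) = p.1 * G p)))
    ∧
    ((∃ X : FoldedSpace m → FoldedSpace m, ContDiff ℝ (⊤ : ℕ∞) X ∧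
        ∀ p v, foldedForm m p (X p) v = - fderiv ℝ f p v)
      ↔
      (∃ f₁ : FoldedSpace m → ℝ, ∃ f₂ : (Fin m → ℝ) × (Fin m → ℝ) → ℝ,
        ContDiff ℝ (⊤ : ℕ∞) f₁ ∧ ContDiff ℝ (⊤ : ℕ∞) f₂ ∧
        ∀ p : FoldedSpace m, f p = p.1 ^ 2 * f₁ p + f₂ (p.2.2.1, p.2.2.2))) := by
  have hAC := folded_A_C m f hf
  have hCB := folded_C_B m f
  have hBA := folded_B_A m f hf
  exact ⟨⟨fun h => hCB (hAC h), hBA⟩, ⟨hAC, fun h => hBA (hCB h)⟩⟩
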